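/- Let α, β, κ be orientation-preserving homeomorphisms of ℝ satisfying α²βα²β²α⁻¹β² = id and, with μ := α⁻¹β⁻², the relations μ = κ^q and α⁻²βα⁻¹ = κ^{p−18q}, where p, q are positive integers with p/q ≥ 10. Then the group generated by α and β has a global fixed point in ℝ. -/

import Mathlib

/-- Core argument: a normal subsemigroup `P` of "positive" elements containing `κ` contains `1`. -/
theorem core_aux {G : Type*} [Group G] (P : G → Prop)
    (hmul : ∀ f g, P f → P g → P (f * g)) (hconj : ∀ f g, P f → P (g * f * g⁻¹))
    (a b k c : G) (p q : ℤ) (hq : 0 < q) (hpq : 10 * q ≤ p)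
    (hrel : b * b * a⁻¹ * b * b * a * a * b * a * a = 1)
    (hc : c = b⁻¹ * b⁻¹ * a⁻¹) (hck : c = k ^ q)
    (hT : k ^ (p - 18 * q) = a⁻¹ * b * a⁻¹ * a⁻¹) (hk : P k) : P 1 := by
  have hpow : ∀ n : ℕ, P (k ^ (n + 1)) := by
    intro n
    induction n with
    | zero => simpa using hk
    | succ n ih => rw [pow_succ]; exact hmul _ _ ih hk
  have hzpow : ∀ n : ℤ, 0 < n → P (k ^ n) := by
    intro n hn
    obtain ⟨m, rfl⟩ : ∃ m : ℕ, n = ((m + 1 : ℕ) : ℤ) := ⟨(n - 1).toNat, by omega⟩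
    rw [zpow_natCast]; exact hpow m
  have hcP : P c := hck ▸ hzpow q hq
  -- the strict order attached to `P`
  have lmul : ∀ u v u' v', P (v * u⁻¹) → P (v' * u'⁻¹) → P ((v * v') * (u * u')⁻¹) := by
    intro u v u' v' h h'
    have := hmul _ _ (hconj _ v h') h
    convert this using 1
    group
  obtain ⟨z, hz⟩ : ∃ z, z = a * b := ⟨_, rfl⟩
  have hb : b = a⁻¹ * z := by rw [hz]; group
  have hzcz : a = z * c * z := by rw [hz, hc]; group
  have hz2 : z = a⁻¹ * c * a * a * c * a⁻¹ := by
    have h1 : (b * b * a⁻¹ * b * b * a * a) * (b * a * a) = 1 := by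
      rw [← hrel]; group
    have h2 := eq_inv_of_mul_eq_one_right h1
    have h3 : z = a * (b * a * a) * a⁻¹ * a⁻¹ := by rw [hz]; group
    rw [h3, h2, hc]; group
  have hX : a = (a⁻¹ * a⁻¹ * c * (a⁻¹ * a⁻¹)⁻¹) * c * (a⁻¹ * c * a⁻¹⁻¹) *
      (a⁻¹ * a⁻¹ * c * (a⁻¹ * a⁻¹)⁻¹) * c := by
    have h1 : a = (a⁻¹ * c * a * a * c * a⁻¹) * c * (a⁻¹ * c * a * a * c * a⁻¹) := by
      rw [← hz2]; exact hzcz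
    calc a = a⁻¹ * a * a := by group
      _ = a⁻¹ * ((a⁻¹ * c * a * a * c * a⁻¹) * c * (a⁻¹ * c * a * a * c * a⁻¹)) * a := by
          rw [← h1]
      _ = _ := by simp only [mul_inv_rev, inv_inv, mul_assoc, inv_mul_cancel_left, mul_inv_cancel_left, inv_mul_cancel, mul_one]
  have hcc : ∀ g, P (g * c * g⁻¹) := fun g => hconj _ g hcP
  have ha : P (a * (c * c)⁻¹) := by
    have h : a * (c * c)⁻¹ = (a⁻¹ * a⁻¹ * c * (a⁻¹ * a⁻¹)⁻¹) *
        (c * ((a⁻¹ * c * a⁻¹⁻¹) * (a⁻¹ * a⁻¹ * c * (a⁻¹ * a⁻¹)⁻¹)) * c⁻¹) := by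
      conv_lhs => rw [hX]
      group
    rw [h]
    exact hmul _ _ (hcc _) (hconj _ _ (hmul _ _ (hcc _) (hcc _)))
  have haz : P (a * z * (c * (c * c))⁻¹) := by
    have h : a * z = c * ((a * a * c * (a * a)⁻¹) * a) := by rw [hz2]; group
    rw [h]
    have h2 : P ((a * a * c * (a * a)⁻¹) * a * (c * c)⁻¹) := by
      rw [mul_assoc]; exact hmul _ _ (hcc _) ha
    have := hconj _ c h2
    convert this using 1
    group
  have hza : P (z * a * (c * c * c)⁻¹) := by
    have h : z * a * (c * c * c)⁻¹ = (a⁻¹ * c * a⁻¹⁻¹) * (a * (c * c)⁻¹) := by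
      rw [hz2]; group
    rw [h]
    exact hmul _ _ (hcc _) ha
  have hzP : P z := by
    have h : z = (a⁻¹ * c * a⁻¹⁻¹) * (a * c * a⁻¹) := by rw [hz2]; group
    rw [h]; exact hmul _ _ (hcc _) (hcc _)
  -- `T⁻¹ c = (az) c z c (za) c`
  have hC : (k ^ (p - 18 * q))⁻¹ * c = (a * z) * (c * z * c * (z * a) * c) := by
    have h1 : a * z * (c * z * c * (z * a) * c) = a * z * c * (z * c * z) * a * c := by group
    rw [h1, ← hzcz, hT, hz, hc]; simp [mul_assoc]
  have hr : P ((c * z * c * (z * a) * c) * (c * c * (c * c * c) * c)⁻¹) := by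
    have h1 : P (c * z * c * (c * c)⁻¹) := by
      have := hconj _ c hzP
      convert this using 1
      group
    have h2 := lmul _ _ _ _ h1 hza
    convert h2 using 1
    group
  have hfin := lmul _ _ _ _ haz hr
  rw [← hC] at hfin
  have he : (k ^ (p - 18 * q))⁻¹ * c * (c * (c * c) * (c * c * (c * c * c) * c))⁻¹
      = k ^ (10 * q - p) := by
    rw [hck]
    simp only [← zpow_add, ← zpow_neg]
    congr 1; ring
  rw [he] at hfin
  rcases hpq.eq_or_lt with h | h
  · rw [← h] at hfin; simpa using hfin
  · have := hmul _ _ hfin (hzpow (p - 10 * q) (by omega))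
    rw [← zpow_add] at this
    simpa using this

/-- A fixed point of `κ` is a global fixed point. -/
theorem fixed_aux (α β : ℝ ≃o ℝ) (x : ℝ)
    (h1 : β.symm (β.symm (α.symm x)) = x)
    (h2 : α.symm (β (α.symm (α.symm x))) = x) : α x = x ∧ β x = x := by
  have e1 : α.symm x = β (β x) := by
    rw [OrderIso.symm_apply_eq, OrderIso.symm_apply_eq] at h1; exact h1
  have e2 : β (α.symm (α.symm x)) = α x := by
    rw [OrderIso.symm_apply_eq] at h2; exact h2
  rcases lt_trichotomy (α x) x with h | h | h
  · exfalso
    have a1 : x < α.symm x := by rw [OrderIso.lt_symm_apply]; exact h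
    have a2 : x < β x := by
      by_contra hb
      push Not at hb
      have := β.monotone hb
      linarith
    have a3 : x < α.symm (α.symm x) := a1.trans (α.symm.strictMono a1)
    have := β.strictMono a3
    linarith
  · refine ⟨h, ?_⟩
    have a1 : α.symm x = x := by rw [OrderIso.symm_apply_eq]; exact h.symm
    rw [a1, a1] at e2
    rw [e2, h]
  · exfalso
    have a1 : α.symm x < x := by rw [OrderIso.symm_apply_lt]; exact h
    have a2 : β x < x := by
      by_contra hb
      push Not at hb
      have := β.monotone hb
      linarith
    have a3 : α.symm (α.symm x) < x := (α.symm.strictMono a1).trans a1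
    have := β.strictMono a3
    linarith

/-- Proposition "real": if `p, q > 0` with `p/q ≥ 10`, any action of the
surgered pretzel knot group on ℝ by orientation-preserving homeomorphisms has a
global fixed point. -/
theorem global_fixed_point_on_R (α β κ μ : ℝ ≃o ℝ) (p q : ℤ)
    (hp : 0 < p) (hq : 0 < q) (hpq : 10 * q ≤ p)
    -- the relation α²βα²β²α⁻¹β² = 1, read as a right action
    (hrel : ∀ x : ℝ, β (β (α.symm (β (β (α (α (β (α (α x))))))))) = x)
    -- μ = α⁻¹β⁻²
    (hμ : ∀ x : ℝ, μ x = β.symm (β.symm (α.symm x)))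
    -- μ = κ^q
    (hμκ : ∀ x : ℝ, μ x = (κ ^ q) x)
    -- κ^{p-18q} = α⁻²βα⁻¹
    (hκ : ∀ x : ℝ, (κ ^ (p - 18 * q)) x = α.symm (β (α.symm (α.symm x)))) :
    ∃ x : ℝ, α x = x ∧ β x = x := by
  have inv_ap : ∀ (f : ℝ ≃o ℝ) (x : ℝ), f⁻¹ x = f.symm x := fun _ _ => rfl
  have mul_ap : ∀ (f g : ℝ ≃o ℝ) (x : ℝ), (f * g) x = f (g x) := fun _ _ _ => rfl
  have one_ap : ∀ x : ℝ, (1 : ℝ ≃o ℝ) x = x := fun _ => rfl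
  by_cases hfix : ∃ x, κ x = x
  · obtain ⟨x, hx⟩ := hfix
    have hpow : ∀ n : ℤ, (κ ^ n) x = x := by
      have hnat : ∀ n : ℕ, (κ ^ n) x = x := by
        intro n
        induction n with
        | zero => rfl
        | succ n ih => rw [pow_succ, mul_ap, hx, ih]
      intro n
      obtain ⟨m, rfl | rfl⟩ := n.eq_nat_or_neg
      · rw [zpow_natCast]; exact hnat m
      · rw [zpow_neg, zpow_natCast, inv_ap, OrderIso.symm_apply_eq, hnat]
    refine ⟨x, fixed_aux α β x ?_ ?_⟩
    · rw [← hμ, hμκ, hpow]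
    · rw [← hκ, hpow]
  · exfalso
    push Not at hfix
    have R1 : β * β * α⁻¹ * β * β * α * α * β * α * α = 1 := by
      ext x; exact hrel x
    have R2 : μ = β⁻¹ * β⁻¹ * α⁻¹ := by ext x; exact hμ x
    have R3 : μ = κ ^ q := by ext x; exact hμκ x
    have R4 : κ ^ (p - 18 * q) = α⁻¹ * β * α⁻¹ * α⁻¹ := by ext x; exact hκ x
    have hcases : (∀ x, x < κ x) ∨ (∀ x, κ x < x) := by
      by_contra hcon
      push Not at hcon
      obtain ⟨⟨x, hx⟩, ⟨y, hy⟩⟩ := hcon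
      obtain ⟨w, hw⟩ := mem_range_of_exists_le_of_exists_ge
        (f := fun t => κ t - t) (c := (0 : ℝ)) (κ.continuous.sub continuous_id)
        ⟨x, by simpa using hx⟩ ⟨y, by simpa using hy⟩
      exact hfix w (sub_eq_zero.mp hw)
    rcases hcases with hpos | hneg
    · have := core_aux (fun f : ℝ ≃o ℝ => ∀ x, x < f x)
        (fun f g hf hg x => (hg x).trans (hf (g x)))
        (fun f g hf x => by
          have := g.strictMono (hf (g.symm x))
          simpa [mul_ap, inv_ap] using this)
        α β κ μ p q hq hpq R1 R2 R3 R4 hpos 0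
      exact lt_irrefl _ this
    · have := core_aux (fun f : ℝ ≃o ℝ => ∀ x, f x < x)
        (fun f g hf hg x => (hf (g x)).trans (hg x))
        (fun f g hf x => by
          have := g.strictMono (hf (g.symm x))
          simpa [mul_ap, inv_ap] using this)
        α β κ μ p q hq hpq R1 R2 R3 R4 hneg 0
      exact lt_irrefl _ this
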